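/- Let E be a complete geodesic space with convex metric and let y∈E. Then the set W_min = { X ∈ P_{b,cl,cv}(E) : min(X,y) is well-posed } is a dense G_δ-set in the metric space (P_{b,cl,cv}(E), h). -/

import Mathlib

open Metric Set Filter Bornology

noncomputable section

/-- A geodesic path of length `l`: a map `c : ℝ → E` that is isometric on `[0, l]`. -/
def IsGeodesicPath {E : Type*} [MetricSpace E] (c : ℝ → E) (l : ℝ) : Prop :=
  0 ≤ l ∧ ∀ s ∈ Icc (0:ℝ) l, ∀ t ∈ Icc (0:ℝ) l, dist (c s) (c t) = |s - t|

/-- `S` is a geodesic segment joining `x` and `y`. -/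
def IsGeodesicSegment {E : Type*} [MetricSpace E] (S : Set E) (x y : E) : Prop :=
  ∃ c l, IsGeodesicPath c l ∧ c 0 = x ∧ c l = y ∧ S = c '' Icc (0:ℝ) l

/-- A geodesic (line): an isometric image of `ℝ`. -/
def IsGeodesicLine {E : Type*} [MetricSpace E] (S : Set E) : Prop :=
  ∃ c : ℝ → E, Isometry c ∧ S = Set.range c

/-- `E` is a geodesic space: every two points are joined by a geodesic path. -/
def IsGeodesicSpace (E : Type*) [MetricSpace E] : Prop :=
  ∀ x y : E, ∃ S, IsGeodesicSegment S x y

/-- `E` has the geodesic extension property: every geodesic segment is contained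
in a geodesic. -/
def GeodesicExtensionProperty (E : Type*) [MetricSpace E] : Prop :=
  ∀ (S : Set E) (x y : E), IsGeodesicSegment S x y → ∃ L, IsGeodesicLine L ∧ S ⊆ L

/-- The metric of `E` is convex. -/
def HasConvexMetric (E : Type*) [MetricSpace E] : Prop :=
  ∀ (c₁ c₂ : ℝ → E) (l₁ l₂ : ℝ), IsGeodesicPath c₁ l₁ → IsGeodesicPath c₂ l₂ →
    ∀ t ∈ Icc (0:ℝ) 1,
      dist (c₁ (t * l₁)) (c₂ (t * l₂)) ≤
        (1 - t) * dist (c₁ 0) (c₂ 0) + t * dist (c₁ l₁) (c₂ l₂)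

/-- A subset `X` is (geodesically) convex: any geodesic segment joining two points
of `X` is contained in `X`. -/
def GeodesicConvex {E : Type*} [MetricSpace E] (X : Set E) : Prop :=
  ∀ x ∈ X, ∀ y ∈ X, ∀ S : Set E, IsGeodesicSegment S x y → S ⊆ X

/-- A function `f : E → ℝ` is (geodesically) convex. -/
def GeodesicConvexFun {E : Type*} [MetricSpace E] (f : E → ℝ) : Prop :=
  ∀ (c : ℝ → E) (l : ℝ), IsGeodesicPath c l → ∀ t ∈ Icc (0:ℝ) 1,
    f (c (t * l)) ≤ (1 - t) * f (c 0) + t * f (c l)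

/-- `G₁(S)`: the union of all geodesic segments with endpoints in `S`. -/
def geodSegUnion {E : Type*} [MetricSpace E] (S : Set E) : Set E :=
  {z | ∃ x ∈ S, ∃ y ∈ S, ∃ T : Set E, IsGeodesicSegment T x y ∧ z ∈ T}

/-- The iterates `G_n(S)`. -/
def geodGn {E : Type*} [MetricSpace E] (S : Set E) : ℕ → Set E
  | 0 => S
  | n + 1 => geodSegUnion (geodGn S n)

/-- The (geodesic) convex hull `co(S) = ⋃ₙ G_n(S)`. -/
def geodConvexHull {E : Type*} [MetricSpace E] (S : Set E) : Set E :=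
  ⋃ n, geodGn S n

/-- `E` is without bifurcating geodesics. -/
def NoBifurcatingGeodesics (E : Type*) [MetricSpace E] : Prop :=
  ∀ (p a b : E) (S₁ S₂ : Set E), IsGeodesicSegment S₁ p a → IsGeodesicSegment S₂ p b →
    ∀ z, z ∈ S₁ → z ∈ S₂ → z ≠ p → (z = a ∧ z = b) ∨ S₁ ⊆ S₂ ∨ S₂ ⊆ S₁

/-- `E` is reflexive: every descending sequence of nonempty, bounded, closed and convex
subsets of `E` has nonempty intersection. -/
def ReflexiveGeodesicSpace (E : Type*) [MetricSpace E] : Prop :=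
  ∀ C : ℕ → Set E, (∀ n, (C n).Nonempty) → (∀ n, IsBounded (C n)) → (∀ n, IsClosed (C n)) →
    (∀ n, GeodesicConvex (C n)) → (∀ n, C (n + 1) ⊆ C n) → (⋂ n, C n).Nonempty

/-- `Dist(x, A)`: the remotal (farthest) distance from `x` to `A`. -/
def supDist {E : Type*} [MetricSpace E] (x : E) (A : Set E) : ℝ :=
  sSup ((fun a => dist x a) '' A)

/-- `λ_{XY} = inf{ d(x,y) : x ∈ X, y ∈ Y }`. -/
def infSetDist {E : Type*} [MetricSpace E] (X Y : Set E) : ℝ :=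
  sInf (Set.image2 dist X Y)

/-- `μ_{XY} = sup{ d(x,y) : x ∈ X, y ∈ Y }`. -/
def supSetDist {E : Type*} [MetricSpace E] (X Y : Set E) : ℝ :=
  sSup (Set.image2 dist X Y)

/-- `L_{XY}(σ) = { x ∈ X : dist(x,Y) ≤ λ_{XY} + σ }`. -/
def Lset {E : Type*} [MetricSpace E] (X Y : Set E) (σ : ℝ) : Set E :=
  {x ∈ X | infDist x Y ≤ infSetDist X Y + σ}

/-- `M_{XY}(σ) = { x ∈ X : Dist(x,Y) ≥ μ_{XY} − σ }`. -/
def Mset {E : Type*} [MetricSpace E] (X Y : Set E) (σ : ℝ) : Set E :=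
  {x ∈ X | supSetDist X Y - σ ≤ supDist x Y}

/-- The minimization problem `min(X,Y)` is well-posed. -/
def MinWellPosed {E : Type*} [MetricSpace E] (X Y : Set E) : Prop :=
  ∃ x₀ ∈ X, ∃ y₀ ∈ Y, dist x₀ y₀ = infSetDist X Y ∧
    (∀ x ∈ X, ∀ y ∈ Y, dist x y = infSetDist X Y → x = x₀ ∧ y = y₀) ∧
    ∀ x : ℕ → E, ∀ y : ℕ → E, (∀ n, x n ∈ X) → (∀ n, y n ∈ Y) →
      Tendsto (fun n => dist (x n) (y n)) atTop (nhds (infSetDist X Y)) →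
      Tendsto x atTop (nhds x₀) ∧ Tendsto y atTop (nhds y₀)

/-- The maximization problem `max(X,Y)` is well-posed. -/
def MaxWellPosed {E : Type*} [MetricSpace E] (X Y : Set E) : Prop :=
  ∃ x₀ ∈ X, ∃ y₀ ∈ Y, dist x₀ y₀ = supSetDist X Y ∧
    (∀ x ∈ X, ∀ y ∈ Y, dist x y = supSetDist X Y → x = x₀ ∧ y = y₀) ∧
    ∀ x : ℕ → E, ∀ y : ℕ → E, (∀ n, x n ∈ X) → (∀ n, y n ∈ Y) →
      Tendsto (fun n => dist (x n) (y n)) atTop (nhds (supSetDist X Y)) →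
      Tendsto x atTop (nhds x₀) ∧ Tendsto y atTop (nhds y₀)

/-- The distance of the model space `M²_κ` (κ < 0): the hyperbolic distance
multiplied by `1/√(-κ)`. -/
def kdist (κ : ℝ) (a b : UpperHalfPlane) : ℝ :=
  (Real.sqrt (-κ))⁻¹ * dist a b

/-- `pb` is the comparison point in `M²_κ` (relative to the side from `xi` to `xj`,
with comparison vertices `xib`, `xjb`) of a point `p` on a geodesic segment from
`xi` to `xj`. -/
def IsComparisonPoint {E : Type*} [MetricSpace E] (κ : ℝ) (xi xj : E)
    (xib xjb : UpperHalfPlane) (p : E) (pb : UpperHalfPlane) : Prop :=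
  kdist κ xib pb = dist xi p ∧ kdist κ pb xjb = dist p xj

/-- `E` has curvature bounded below by `κ < 0`: every geodesic triangle satisfies the
reversed CAT(κ) inequality with respect to any κ-comparison triangle in `M²_κ`. -/
def CurvBoundedBelow (E : Type*) [MetricSpace E] (κ : ℝ) : Prop :=
  ∀ (x₁ x₂ x₃ : E) (S₁₂ S₂₃ S₁₃ : Set E),
    IsGeodesicSegment S₁₂ x₁ x₂ → IsGeodesicSegment S₂₃ x₂ x₃ → IsGeodesicSegment S₁₃ x₁ x₃ →
    ∀ x₁b x₂b x₃b : UpperHalfPlane,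
      kdist κ x₁b x₂b = dist x₁ x₂ → kdist κ x₂b x₃b = dist x₂ x₃ →
      kdist κ x₁b x₃b = dist x₁ x₃ →
      ∀ (p q : E) (pb qb : UpperHalfPlane),
        ((p ∈ S₁₂ ∧ IsComparisonPoint κ x₁ x₂ x₁b x₂b p pb) ∨
         (p ∈ S₂₃ ∧ IsComparisonPoint κ x₂ x₃ x₂b x₃b p pb) ∨
         (p ∈ S₁₃ ∧ IsComparisonPoint κ x₁ x₃ x₁b x₃b p pb)) →
        ((q ∈ S₁₂ ∧ IsComparisonPoint κ x₁ x₂ x₁b x₂b q qb) ∨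
         (q ∈ S₂₃ ∧ IsComparisonPoint κ x₂ x₃ x₂b x₃b q qb) ∨
         (q ∈ S₁₃ ∧ IsComparisonPoint κ x₁ x₃ x₁b x₃b q qb)) →
        kdist κ pb qb ≤ dist p q

/-- Comparison points for Euclidean (κ = 0) comparison triangles in `ℝ²`. -/
def IsComparisonPointE {E : Type*} [MetricSpace E] (xi xj : E)
    (xib xjb : EuclideanSpace ℝ (Fin 2)) (p : E) (pb : EuclideanSpace ℝ (Fin 2)) : Prop :=
  dist xib pb = dist xi p ∧ dist pb xjb = dist p xj

/-- `E` is a CAT(0) space: a geodesic space where every geodesic triangle satisfies the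
CAT(0) comparison inequality with respect to Euclidean comparison triangles. -/
def CATZero (E : Type*) [MetricSpace E] : Prop :=
  IsGeodesicSpace E ∧
  ∀ (x₁ x₂ x₃ : E) (S₁₂ S₂₃ S₁₃ : Set E),
    IsGeodesicSegment S₁₂ x₁ x₂ → IsGeodesicSegment S₂₃ x₂ x₃ → IsGeodesicSegment S₁₃ x₁ x₃ →
    ∀ x₁b x₂b x₃b : EuclideanSpace ℝ (Fin 2),
      dist x₁b x₂b = dist x₁ x₂ → dist x₂b x₃b = dist x₂ x₃ → dist x₁b x₃b = dist x₁ x₃ →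
      ∀ (p q : E) (pb qb : EuclideanSpace ℝ (Fin 2)),
        ((p ∈ S₁₂ ∧ IsComparisonPointE x₁ x₂ x₁b x₂b p pb) ∨
         (p ∈ S₂₃ ∧ IsComparisonPointE x₂ x₃ x₂b x₃b p pb) ∨
         (p ∈ S₁₃ ∧ IsComparisonPointE x₁ x₃ x₁b x₃b p pb)) →
        ((q ∈ S₁₂ ∧ IsComparisonPointE x₁ x₂ x₁b x₂b q qb) ∨
         (q ∈ S₂₃ ∧ IsComparisonPointE x₂ x₃ x₂b x₃b q qb) ∨
         (q ∈ S₁₃ ∧ IsComparisonPointE x₁ x₃ x₁b x₃b q qb)) →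
        dist p q ≤ dist pb qb

/-- The space `P_{b,cl,cv}(E)` of nonempty, bounded, closed and convex subsets of `E`. -/
def Pbclcv (E : Type*) [MetricSpace E] : Type _ :=
  {X : Set E // X.Nonempty ∧ IsBounded X ∧ IsClosed X ∧ GeodesicConvex X}

/-- `P_{b,cl,cv}(E)` carries the Pompeiu-Hausdorff distance. -/
instance Pbclcv.metricSpace (E : Type*) [MetricSpace E] : MetricSpace (Pbclcv E) where
  dist X Y := hausdorffDist X.1 Y.1
  dist_self X := hausdorffDist_self_zero
  dist_comm X Y := hausdorffDist_comm
  dist_triangle X Y Z := hausdorffDist_triangle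
    (hausdorffEdist_ne_top_of_nonempty_of_bounded X.2.1 Y.2.1 X.2.2.1 Y.2.2.1)
  eq_of_dist_eq_zero := by
    intro X Y h
    exact Subtype.ext ((X.2.2.2.1.hausdorffDist_zero_iff_eq Y.2.2.2.1
      (hausdorffEdist_ne_top_of_nonempty_of_bounded X.2.1 Y.2.1 X.2.2.1 Y.2.2.1)).mp h)

/-- `P^A_{b,cl,cv}(E)`: the closure in `(P_{b,cl,cv}(E), h)` of the family of sets at
positive distance from `A`. -/
def PAbclcv {E : Type*} [MetricSpace E] (A : Set E) : Set (Pbclcv E) :=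
  closure {X : Pbclcv E | 0 < infSetDist X.1 A}

/-- The inverse hyperbolic cosine. -/
def arcosh (x : ℝ) : ℝ := Real.log (x + Real.sqrt (x ^ 2 - 1))

/-- The function `F_κ`. -/
def Fkappa (κ d r σ : ℝ) : ℝ :=
  2 / Real.sqrt (-κ) *
    arcosh (Real.cosh (Real.sqrt (-κ) * (r - d + σ)) ^ 2 -
      Real.sinh (Real.sqrt (-κ) * (r - d + σ)) / Real.sinh (Real.sqrt (-κ) * d) *
        (Real.cosh (Real.sqrt (-κ) * r) -
          Real.cosh (Real.sqrt (-κ) * d) * Real.cosh (Real.sqrt (-κ) * (r - d + σ))))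

/-- The petal `P_{α,δ}(x₀, f)`. -/
def petal {E : Type*} [MetricSpace E] (f : E → ℝ) (α δ : ℝ) (x₀ : E) : Set E :=
  {x | f x ≤ f x₀ - α * dist x x₀ + δ}

/-- `L_{A,f}(σ)`. -/
def LsetFun {E : Type*} [MetricSpace E] (A : Set E) (f : E → ℝ) (σ : ℝ) : Set E :=
  {x | f x ≤ sInf (f '' A) + σ ∧ infDist x A ≤ σ}

/-- The problem `min(A,f)` is well-posed in the sense of Revalski. -/
def RevalskiWellPosed {E : Type*} [MetricSpace E] (A : Set E) (f : E → ℝ) : Prop :=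
  sInf ((fun σ => diam (LsetFun A f σ)) '' Ioi 0) = 0

/-- The nearest point problem `min(X,y)` is well-posed. -/
def PointMinWellPosed {E : Type*} [MetricSpace E] (X : Set E) (y : E) : Prop :=
  ∃ x₀ ∈ X, dist x₀ y = infDist y X ∧ (∀ x ∈ X, dist x y = infDist y X → x = x₀) ∧
    ∀ x : ℕ → E, (∀ n, x n ∈ X) →
      Tendsto (fun n => dist (x n) y) atTop (nhds (infDist y X)) →
      Tendsto x atTop (nhds x₀)

end

section WellPosedness

variable {E : Type*} [MetricSpace E]

lemma infDist_geodesic_le (hgeo : IsGeodesicSpace E) (hconv : HasConvexMetric E) {X : Set E}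
    (hX : GeodesicConvex X) {c : ℝ → E} {l : ℝ} (hc : IsGeodesicPath c l) {t : ℝ}
    (ht : t ∈ Icc (0 : ℝ) 1) {a b : E} (ha : a ∈ X) (hb : b ∈ X) :
    infDist (c (t * l)) X ≤ (1 - t) * dist (c 0) a + t * dist (c l) b := by
  obtain ⟨S, hS⟩ := hgeo a b
  have hSX : S ⊆ X := hX a ha b hb S hS
  obtain ⟨c', l', hc', rfl, rfl, rfl⟩ := hS
  refine (infDist_le_dist_of_mem (hSX ⟨t * l', ⟨?_, ?_⟩, rfl⟩)).trans (hconv c c' l l' hc hc' t ht)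
  · exact mul_nonneg ht.1 hc'.1
  · exact mul_le_of_le_one_left hc'.1 ht.2

lemma geodesicConvexFun_infDist (hgeo : IsGeodesicSpace E) (hconv : HasConvexMetric E)
    {X : Set E} (hne : X.Nonempty) (hX : GeodesicConvex X) :
    GeodesicConvexFun (fun z => infDist z X) := by
  intro c l hc t ht
  refine le_of_forall_pos_le_add fun η hη => ?_
  obtain ⟨a, ha, hda⟩ := (infDist_lt_iff hne).1 (lt_add_of_pos_right (infDist (c 0) X) hη)
  obtain ⟨b, hb, hdb⟩ := (infDist_lt_iff hne).1 (lt_add_of_pos_right (infDist (c l) X) hη)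
  have h := infDist_geodesic_le hgeo hconv hX hc ht ha hb
  have h1 := mul_le_mul_of_nonneg_left hda.le (sub_nonneg.2 ht.2)
  have h2 := mul_le_mul_of_nonneg_left hdb.le ht.1
  dsimp only
  linarith

lemma geodesicConvexFun_dist (hconv : HasConvexMetric E) (p : E) :
    GeodesicConvexFun (fun z => dist z p) := by
  intro c l hc t ht
  have hp : IsGeodesicPath (fun _ : ℝ => p) 0 := by
    refine ⟨le_rfl, fun s hs t ht => ?_⟩
    rw [le_antisymm hs.2 hs.1, le_antisymm ht.2 ht.1]
    simp
  exact hconv c (fun _ => p) l 0 hc hp t ht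

lemma GeodesicConvexFun.geodesicConvex_le {f : E → ℝ} (hf : GeodesicConvexFun f) (r : ℝ) :
    GeodesicConvex {z | f z ≤ r} := by
  rintro _ hx _ hy _ ⟨c, l, hc, rfl, rfl, rfl⟩ _ ⟨s, hs, rfl⟩
  simp only [mem_ofPred_eq] at hx hy ⊢
  rcases hc.1.eq_or_lt with h0 | hl
  · have : s = 0 := le_antisymm (h0 ▸ hs.2) hs.1
    rwa [this]
  · have ht : s / l ∈ Icc (0 : ℝ) 1 := ⟨div_nonneg hs.1 hl.le, (div_le_one hl).2 hs.2⟩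
    have h := hf c l hc (s / l) ht
    rw [div_mul_cancel₀ _ hl.ne'] at h
    have h1 := mul_le_mul_of_nonneg_left hx (sub_nonneg.2 ht.2)
    have h2 := mul_le_mul_of_nonneg_left hy ht.1
    linarith

lemma Pbclcv.dist_def (X Y : Pbclcv E) : dist X Y = hausdorffDist X.1 Y.1 := rfl

lemma Pbclcv.hausdorffEDist_ne_top (X Y : Pbclcv E) : hausdorffEDist X.1 Y.1 ≠ ⊤ :=
  hausdorffEDist_ne_top_of_nonempty_of_bounded X.2.1 Y.2.1 X.2.2.1 Y.2.2.1

/-- The inclusion of `P_{b,cl,cv}(E)` into the closed subsets of `E`. -/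
def Pbclcv.toCloseds (X : Pbclcv E) : TopologicalSpace.Closeds E := ⟨X.1, X.2.2.2.1⟩

lemma Pbclcv.isometry_toCloseds : Isometry (Pbclcv.toCloseds (E := E)) := by
  intro X Y
  rw [edist_dist, Pbclcv.dist_def, hausdorffDist,
    ENNReal.ofReal_toReal (Pbclcv.hausdorffEDist_ne_top X Y)]
  rfl

lemma Pbclcv.isClosed_range_toCloseds (hgeo : IsGeodesicSpace E) (hconv : HasConvexMetric E) :
    IsClosed (range (Pbclcv.toCloseds (E := E))) := by
  refine isClosed_of_closure_subset fun K hK => ?_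
  have happrox : ∀ η : ℝ, 0 < η → ∃ X : Pbclcv E,
      hausdorffEDist (K : Set E) X.1 < ENNReal.ofReal η := by
    intro η hη
    obtain ⟨_, ⟨X, rfl⟩, hX⟩ := EMetric.mem_closure_iff.1 hK _ (ENNReal.ofReal_pos.2 hη)
    exact ⟨X, hX⟩
  have hne : (K : Set E).Nonempty := by
    obtain ⟨X, hX⟩ := happrox 1 one_pos
    refine nonempty_of_hausdorffEDist_ne_top X.2.1 ?_
    rw [hausdorffEDist_comm]
    exact hX.ne_top
  have hbdd : IsBounded (K : Set E) := by
    obtain ⟨X, hX⟩ := happrox 1 one_pos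
    refine (X.2.2.1.cthickening (δ := 1)).subset fun z hz => ?_
    rw [mem_cthickening_iff]
    exact (infEDist_le_hausdorffEDist_of_mem hz).trans hX.le
  refine ⟨⟨K, hne, hbdd, K.isClosed, ?_⟩, rfl⟩
  intro a ha b hb S hS z hz
  rw [← K.isClosed.closure_eq, mem_closure_iff_infDist_zero hne]
  refine le_antisymm (le_of_forall_pos_le_add fun η hη => ?_) infDist_nonneg
  obtain ⟨X, hX⟩ := happrox (η / 2) (half_pos hη)
  have hfin := hX.ne_top
  have hd : hausdorffDist (K : Set E) X.1 ≤ η / 2 := by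
    rw [hausdorffDist]
    exact ENNReal.toReal_le_of_le_ofReal (half_pos hη).le hX.le
  have hsub := (geodesicConvexFun_infDist hgeo hconv X.2.1 X.2.2.2.2).geodesicConvex_le (η / 2)
    a ((infDist_le_hausdorffDist_of_mem ha hfin).trans hd)
    b ((infDist_le_hausdorffDist_of_mem hb hfin).trans hd) S hS hz
  have := infDist_le_infDist_add_hausdorffDist (x := z) (s := X.1) (t := (K : Set E))
    (by rwa [hausdorffEDist_comm])
  rw [hausdorffDist_comm] at this
  simp only [mem_ofPred_eq] at hsub
  linarith

lemma Pbclcv.completeSpace [CompleteSpace E] (hgeo : IsGeodesicSpace E)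
    (hconv : HasConvexMetric E) : CompleteSpace (Pbclcv E) :=
  (completeSpace_iff_isComplete_range Pbclcv.isometry_toCloseds.isUniformInducing).2
    (Pbclcv.isClosed_range_toCloseds hgeo hconv).isComplete

/-- The points of `X` whose distance to `y` is within `σ` of being minimal. -/
def nearMinimizers (X : Set E) (y : E) (σ : ℝ) : Set E :=
  {x ∈ X | dist x y ≤ infDist y X + σ}

/-- The sets `X` for which the near-minimizers of the distance to `y` eventually have diameter
less than `ε`. -/
def smallNearMinimizers (y : E) (ε : ℝ) : Set (Pbclcv E) :=
  {X | ∃ σ > 0, ∃ ρ < ε, ∀ a ∈ nearMinimizers X.1 y σ, ∀ b ∈ nearMinimizers X.1 y σ,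
    dist a b ≤ ρ}

lemma isOpen_smallNearMinimizers (y : E) (ε : ℝ) : IsOpen (smallNearMinimizers y ε) := by
  rw [Metric.isOpen_iff]
  rintro X ⟨σ, hσ, ρ, hρ, h⟩
  obtain ⟨η, hη, hησ, hηρ⟩ : ∃ η > 0, 3 * η ≤ σ ∧ 2 * η < ε - ρ :=
    ⟨min (σ / 3) ((ε - ρ) / 3), lt_min (by linarith) (by linarith),
      by linarith [min_le_left (σ / 3) ((ε - ρ) / 3)],
      by linarith [min_le_right (σ / 3) ((ε - ρ) / 3)]⟩
  refine ⟨η, hη, fun Y hY => ⟨η, hη, ρ + 2 * η, by linarith, ?_⟩⟩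
  have hYX : hausdorffDist Y.1 X.1 < η := hY
  have hfin := Pbclcv.hausdorffEDist_ne_top Y X
  have hinf : infDist y Y.1 ≤ infDist y X.1 + η := by
    have := infDist_le_infDist_add_hausdorffDist (x := y) (Pbclcv.hausdorffEDist_ne_top X Y)
    rw [hausdorffDist_comm] at this
    linarith
  have key : ∀ a ∈ nearMinimizers Y.1 y η, ∃ a' ∈ nearMinimizers X.1 y σ, dist a a' < η := by
    rintro a ⟨haY, ha⟩
    obtain ⟨a', ha', hd⟩ := exists_dist_lt_of_hausdorffDist_lt haY hYX hfin
    refine ⟨a', ⟨ha', ?_⟩, hd⟩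
    have := dist_triangle_left a' y a
    linarith
  intro a ha b hb
  obtain ⟨a', ha', hda⟩ := key a ha
  obtain ⟨b', hb', hdb⟩ := key b hb
  have := h a' ha' b' hb'
  have := dist_triangle4_right a b a' b'
  linarith

lemma nearMinimizers_nonempty {X : Set E} (hX : X.Nonempty) (y : E) {σ : ℝ} (hσ : 0 < σ) :
    (nearMinimizers X y σ).Nonempty := by
  obtain ⟨x, hx, hd⟩ := (infDist_lt_iff hX).1 (lt_add_of_pos_right (infDist y X) hσ)
  exact ⟨x, hx, by rw [dist_comm]; exact hd.le⟩

lemma tendsto_dist_of_mem_nearMinimizers {X : Set E} {y : E} {x : ℕ → E}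
    (hx : ∀ n : ℕ, x n ∈ nearMinimizers X y (1 / ((n : ℝ) + 1))) :
    Tendsto (fun n => dist (x n) y) atTop (nhds (infDist y X)) := by
  refine tendsto_of_tendsto_of_tendsto_of_le_of_le tendsto_const_nhds
    (h := fun n : ℕ => infDist y X + 1 / ((n : ℝ) + 1)) ?_ (fun n => ?_) fun n => (hx n).2
  · simpa using tendsto_const_nhds.add (tendsto_one_div_add_atTop_nhds_zero_nat (𝕜 := ℝ))
  · rw [dist_comm]
    exact infDist_le_dist_of_mem (hx n).1

lemma PointMinWellPosed.mem_smallNearMinimizers {X : Pbclcv E} {y : E}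
    (h : PointMinWellPosed X.1 y) {ε : ℝ} (hε : 0 < ε) : X ∈ smallNearMinimizers y ε := by
  obtain ⟨x₀, -, -, -, hlim⟩ := h
  by_contra hcon
  have hex : ∀ n : ℕ, ∃ a ∈ nearMinimizers X.1 y (1 / ((n : ℝ) + 1)),
      ∃ b ∈ nearMinimizers X.1 y (1 / ((n : ℝ) + 1)), ε / 2 < dist a b := by
    intro n
    by_contra! hn
    exact hcon ⟨1 / ((n : ℝ) + 1), by positivity, ε / 2, half_lt_self hε, hn⟩
  choose a ha b hb hab using hex
  have hlima := hlim a (fun n => (ha n).1) (tendsto_dist_of_mem_nearMinimizers ha)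
  have hlimb := hlim b (fun n => (hb n).1) (tendsto_dist_of_mem_nearMinimizers hb)
  have hd := hlima.dist hlimb
  rw [dist_self] at hd
  have := ge_of_tendsto' hd fun n => (hab n).le
  linarith

lemma pointMinWellPosed_of_forall_mem_smallNearMinimizers [CompleteSpace E] {X : Pbclcv E} {y : E}
    (h : ∀ ε > 0, X ∈ smallNearMinimizers y ε) : PointMinWellPosed X.1 y := by
  have hclose : ∀ u v : ℕ → E, (∀ n, u n ∈ X.1) → (∀ n, v n ∈ X.1) →
      Tendsto (fun n => dist (u n) y) atTop (nhds (infDist y X.1)) →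
      Tendsto (fun n => dist (v n) y) atTop (nhds (infDist y X.1)) →
      ∀ ε > 0, ∃ N, ∀ m ≥ N, ∀ n ≥ N, dist (u m) (v n) < ε := by
    intro u v hu hv hlu hlv ε hε
    obtain ⟨σ, hσ, ρ, hρ, hd⟩ := h ε hε
    have hlt := lt_add_of_pos_right (infDist y X.1) hσ
    obtain ⟨N, hN⟩ := eventually_atTop.1
      ((hlu.eventually_lt_const hlt).and (hlv.eventually_lt_const hlt))
    exact ⟨N, fun m hm n hn =>
      (hd _ ⟨hu m, (hN m hm).1.le⟩ _ ⟨hv n, (hN n hn).2.le⟩).trans_lt hρ⟩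
  choose x hx using fun n : ℕ =>
    nearMinimizers_nonempty X.2.1 y (σ := 1 / ((n : ℝ) + 1)) (by positivity)
  have hlx := tendsto_dist_of_mem_nearMinimizers hx
  have hxX := fun n => (hx n).1
  obtain ⟨x₀, hx₀⟩ := cauchySeq_tendsto_of_complete
    (Metric.cauchySeq_iff.2 (hclose x x hxX hxX hlx hlx))
  have hx₀X : x₀ ∈ X.1 := X.2.2.2.1.mem_of_tendsto hx₀ (Eventually.of_forall hxX)
  have hdx₀ : dist x₀ y = infDist y X.1 :=
    tendsto_nhds_unique (hx₀.dist tendsto_const_nhds) hlx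
  have hlim : ∀ u : ℕ → E, (∀ n, u n ∈ X.1) →
      Tendsto (fun n => dist (u n) y) atTop (nhds (infDist y X.1)) →
      Tendsto u atTop (nhds x₀) := by
    intro u hu hlu
    refine Metric.tendsto_atTop.2 fun ε hε => ?_
    obtain ⟨N, hN⟩ := hclose u (fun _ => x₀) hu (fun _ => hx₀X) hlu
      (by rw [hdx₀]; exact tendsto_const_nhds) ε hε
    exact ⟨N, fun n hn => hN n hn N le_rfl⟩
  refine ⟨x₀, hx₀X, hdx₀, fun z hz hdz => ?_, hlim⟩
  exact tendsto_nhds_unique tendsto_const_nhds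
    (hlim (fun _ => z) (fun _ => hz) (by rw [hdz]; exact tendsto_const_nhds))

lemma dense_smallNearMinimizers (hgeo : IsGeodesicSpace E) (hconv : HasConvexMetric E) (y : E)
    {τ : ℝ} (hτ : 0 < τ) : Dense (smallNearMinimizers y τ) := by
  refine Metric.dense_iff.2 fun X ε hε => ?_
  rcases (infDist_nonneg (x := y) (s := X.1)).eq_or_lt with hd | hd
  · refine ⟨X, mem_ball_self hε, τ / 4, by linarith, τ / 2, by linarith, ?_⟩
    rintro a ⟨-, ha⟩ b ⟨-, hb⟩
    have := dist_triangle_right a b y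
    linarith
  obtain ⟨r, hr, hrε, hrd⟩ : ∃ r > 0, r < ε ∧ r ≤ infDist y X.1 :=
    ⟨min (ε / 2) (infDist y X.1), lt_min (half_pos hε) hd,
      (min_le_left _ _).trans_lt (half_lt_self hε), min_le_right _ _⟩
  obtain ⟨D, hD, hXD⟩ := X.2.2.1.subset_closedBall_lt 0 y
  set β := r / (2 * D) with hβ_def
  have hβ : 0 < β := by positivity
  set δ := β * τ / 8 with hδ_def
  have hδ : 0 < δ := by positivity
  obtain ⟨x, hxX, hx⟩ := nearMinimizers_nonempty X.2.1 y hδ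
  obtain ⟨-, c, l, hc, rfl, rfl, -⟩ := hgeo x y
  have hl : dist (c 0) (c l) = l := by
    rw [hc.2 0 ⟨le_rfl, hc.1⟩ l ⟨hc.1, le_rfl⟩, zero_sub, abs_neg, abs_of_nonneg hc.1]
  have hrl : r ≤ l := by
    have := infDist_le_dist_of_mem (x := c l) hxX
    rw [dist_comm, hl] at this
    linarith
  have hxp : dist (c r) (c 0) = r := by
    rw [hc.2 r ⟨hr.le, hrl⟩ 0 ⟨le_rfl, hc.1⟩, sub_zero, abs_of_pos hr]
  have hpy : dist (c r) (c l) = l - r := by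
    rw [hc.2 r ⟨hr.le, hrl⟩ l ⟨hc.1, le_rfl⟩, abs_sub_comm, abs_of_nonneg (by linarith)]
  set y := c l
  set p := c r
  rw [hl] at hx
  have hlD : l ≤ D := by
    have := hXD hxX
    rwa [mem_closedBall, hl] at this
  set Z : Set E := {z | infDist z X.1 + β * dist z p ≤ r} with hZ_def
  have hpZ : p ∈ Z := by
    have := infDist_le_dist_of_mem (x := p) hxX
    simp only [hZ_def, mem_ofPred_eq, dist_self, mul_zero, add_zero]
    linarith
  have hXZ : X.1 ⊆ Z := by
    intro z hz
    have hzy : dist z y ≤ D := hXD hz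
    have hzp : dist z p ≤ 2 * D := by
      have := dist_triangle_right z p y
      linarith
    have h1 : β * dist z p ≤ β * (2 * D) := mul_le_mul_of_nonneg_left hzp hβ.le
    have h2 : β * (2 * D) = r := by rw [hβ_def]; field_simp
    simp only [hZ_def, mem_ofPred_eq, infDist_zero_of_mem hz]
    linarith
  have hZclosed : IsClosed Z := by
    refine isClosed_le ?_ continuous_const
    exact (continuous_infDist_pt X.1).add
      (continuous_const.mul (continuous_id.dist continuous_const))
  have hZbdd : IsBounded Z := by
    refine isBounded_closedBall.subset (fun z hz => ?_ : Z ⊆ closedBall p (r / β))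
    rw [mem_closedBall, le_div_iff₀ hβ, mul_comm]
    exact le_trans (le_add_of_nonneg_left infDist_nonneg) hz
  have hZconv : GeodesicConvex Z := by
    refine GeodesicConvexFun.geodesicConvex_le (f := fun z => infDist z X.1 + β * dist z p) ?_ r
    intro c l hc t ht
    have h1 := geodesicConvexFun_infDist hgeo hconv X.2.1 X.2.2.2.2 c l hc t ht
    have h2 := mul_le_mul_of_nonneg_left (geodesicConvexFun_dist hconv p c l hc t ht) hβ.le
    dsimp only at h1 h2 ⊢
    linarith
  have hdist : hausdorffDist Z X.1 ≤ r := by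
    refine hausdorffDist_le_of_infDist hr.le (fun z hz => ?_) fun z hz => ?_
    · exact le_trans (le_add_of_nonneg_right (by positivity)) hz
    · rw [infDist_zero_of_mem (hXZ hz)]
      exact hr.le
  refine ⟨⟨Z, ⟨p, hpZ⟩, hZbdd, hZclosed, hZconv⟩, hdist.trans_lt hrε,
    δ, hδ, τ / 2, half_lt_self hτ, ?_⟩
  have key : ∀ z ∈ nearMinimizers Z y δ, dist z p ≤ τ / 4 := by
    rintro z ⟨hzZ, hz⟩
    have h1 : infDist y Z ≤ l - r := by
      rw [← hpy, dist_comm]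
      exact infDist_le_dist_of_mem hpZ
    have h2 : infDist y X.1 ≤ infDist z X.1 + dist y z := infDist_le_infDist_add_dist
    have h3 : infDist z X.1 + β * dist z p ≤ r := hzZ
    rw [dist_comm y z] at h2
    have h4 : β * dist z p ≤ β * (τ / 4) := by linarith
    exact le_of_mul_le_mul_left h4 hβ
  intro a ha b hb
  have := dist_triangle_right a b p
  have := key a ha
  have := key b hb
  linarith

lemma setOf_pointMinWellPosed_eq_iInter [CompleteSpace E] (y : E) :
    {X : Pbclcv E | PointMinWellPosed X.1 y} =
      ⋂ n : ℕ, smallNearMinimizers y (1 / ((n : ℝ) + 1)) := by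
  ext X
  simp only [mem_ofPred_eq, mem_iInter]
  refine ⟨fun h n => h.mem_smallNearMinimizers (by positivity), fun h =>
    pointMinWellPosed_of_forall_mem_smallNearMinimizers fun ε hε => ?_⟩
  obtain ⟨n, hn⟩ := exists_nat_one_div_lt hε
  obtain ⟨σ, hσ, ρ, hρ, hd⟩ := h n
  exact ⟨σ, hσ, ρ, hρ.trans hn, hd⟩

end WellPosedness

/-- the family of sets `X` for which the nearest point problem
`min(X,y)` is well-posed is a dense `G_δ`-set in `P_{b,cl,cv}(E)`. -/
theorem statement17 {E : Type*} [MetricSpace E] [CompleteSpace E]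
    (hgeo : IsGeodesicSpace E) (hconv : HasConvexMetric E) (y : E) :
    Dense {X : Pbclcv E | PointMinWellPosed X.1 y} ∧
    IsGδ {X : Pbclcv E | PointMinWellPosed X.1 y} := by
  have := Pbclcv.completeSpace hgeo hconv
  rw [setOf_pointMinWellPosed_eq_iInter]
  exact ⟨dense_iInter_of_isOpen (fun _ => isOpen_smallNearMinimizers _ _)
      fun _ => dense_smallNearMinimizers hgeo hconv y (by positivity),
    IsGδ.iInter_of_isOpen fun _ => isOpen_smallNearMinimizers _ _⟩
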